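/- arXiv:2507.09939 — 2 statements merged into one kernel-verified Lean document; each statement's English description precedes it below -/
import Mathlib

section
/- Let a, w ∈ 𝒜. The following are equivalent: (1) a is w-EP; (2) there exists x ∈ 𝒜 such that a(wx)² = x, awxwa = a, and (awxw)* = xwaw; (3) there exists x ∈ 𝒜 such that (xw)²a = x, awxwa = a, and (awxw)* = xwaw. -/
variable {A : Type*} [NormedRing A] [StarRing A] [NormedAlgebra ℂ A] [CompleteSpace A]

/-- `q` is quasinilpotent: `‖q^n‖^(1/n) → 0`. -/
def IsQuasinilpotent (q : A) : Prop :=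
  Filter.Tendsto (fun n : ℕ => ‖q ^ n‖ ^ (1 / (n : ℝ))) Filter.atTop (nhds 0)

/-- `a` is `w`-EP. -/
def IsWEP (w a : A) : Prop :=
  ∃ x : A, a * (w * x) ^ 2 = x ∧ x * (w * a) ^ 2 = a ∧
    star (a * w * x * w) = a * w * x * w ∧ star (x * w * a * w) = x * w * a * w

/-- `x` is a `w`-group inverse of `a`. -/
def IsWGroupInv (w a x : A) : Prop :=
  a * w * x * w * a = a ∧ x * w * a * w * x = x ∧ a * w * x = x * w * a

/-- `a` is generalized `w`-EP. -/
def IsGenWEP (w a : A) : Prop :=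
  ∃ x : A, a * (w * x) ^ 2 = x ∧ star (a * w * x * w) = a * w * x * w ∧
    star (x * w * a * w) = x * w * a * w ∧
    Filter.Tendsto
      (fun n : ℕ => ‖(a * w) ^ n - x * w * (a * w) ^ (n + 1)‖ ^ (1 / (n : ℝ)))
      Filter.atTop (nhds 0)

/-- `a` is `w`-*-DMP. -/
def IsWStarDMP (w a : A) : Prop :=
  ∃ x : A, ∃ n : ℕ, 1 ≤ n ∧ a * (w * x) ^ 2 = x ∧
    star (a * w * x * w) = a * w * x * w ∧ star (x * w * a * w) = x * w * a * w ∧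
    (a * w) ^ n = x * w * (a * w) ^ (n + 1)

/-- If `y = b * y ^ 2` and `b = y * b ^ 2` with `b * y` and `y * b` self-adjoint, then `b` and `y`
commute. -/
theorem mul_comm_of_isSelfAdjoint_mul {R : Type*} [Semigroup R] [StarMul R] {b y : R}
    (hy : b * (y * y) = y) (hb : y * (b * b) = b)
    (hby : star (b * y) = b * y) (hyb : star (y * b) = y * b) : b * y = y * b := by
  have h₁ : b * y * (y * b) = y * b := by
    rw [← mul_assoc, mul_assoc b, hy]
  have h₂ : y * b * (b * y) = b * y := by
    rw [← mul_assoc, mul_assoc y, hb]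
  have h₃ := congrArg star h₁
  rw [star_mul, hby, hyb, h₂] at h₃
  exact h₃

/-- If `star (b * y) = y * b` and the product `b * y * (y * b)` collapses to one of its two
factors, then `b` and `y` commute. -/
theorem mul_comm_of_star_mul_eq {R : Type*} [Semigroup R] [StarMul R] {b y : R}
    (hs : star (b * y) = y * b)
    (h : b * y * (y * b) = y * b ∨ b * y * (y * b) = b * y) : b * y = y * b := by
  have hs' : star (y * b) = b * y := by rw [← hs, star_star]
  rcases h with h | h
  · have h' := congrArg star h
    rw [star_mul, hs, hs', h] at h'
    exact h'.symm
  · have h' := congrArg star h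
    rw [star_mul, hs, hs', h] at h'
    exact h'

theorem stmt_4 (a w : A) :
    [ IsWEP w a,
      (∃ x : A, a * (w * x) ^ 2 = x ∧ a * w * x * w * a = a ∧
        star (a * w * x * w) = x * w * a * w),
      (∃ x : A, (x * w) ^ 2 * a = x ∧ a * w * x * w * a = a ∧
        star (a * w * x * w) = x * w * a * w) ].TFAE := by
  tfae_have 1 → 3 := by
    rintro ⟨x, hx, ha, h₁, h₂⟩
    have hx' : a * w * (x * w * x) = x := by
      simpa only [pow_two, mul_assoc] using hx
    have ha' : x * w * (a * w * a) = a := by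
      simpa only [pow_two, mul_assoc] using ha
    have hy : a * w * (x * w * (x * w)) = x * w := by
      simpa only [mul_assoc] using congrArg (· * w) hx'
    have hb : x * w * (a * w * (a * w)) = a * w := by
      simpa only [mul_assoc] using congrArg (· * w) ha'
    have hc : a * w * (x * w) = x * w * (a * w) :=
      mul_comm_of_isSelfAdjoint_mul hy hb (by simpa only [mul_assoc] using h₁)
        (by simpa only [mul_assoc] using h₂)
    have hxw : (x * w) ^ 2 * a * w = x * w := by
      rw [pow_two, mul_assoc, mul_assoc (x * w), ← hc, ← mul_assoc, ← hc, mul_assoc, hy]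
    refine ⟨(x * w) ^ 2 * a, by rw [hxw], ?_, ?_⟩
    · rw [mul_assoc (a * w) _ w, hxw, hc, mul_assoc, ha']
    · rw [mul_assoc (a * w) _ w, hxw, ← mul_assoc, h₁, mul_assoc _ x w, hc, mul_assoc (x * w)]
  tfae_have 3 → 2 := by
    rintro ⟨x, hx, ha, hs⟩
    have hx' : x * w * (x * w * a) = x := by
      rwa [pow_two, mul_assoc] at hx
    have ha' : a * w * (x * w * a) = a := by
      simpa only [mul_assoc] using ha
    have hy : x * w * (x * w * (a * w)) = x * w := by
      simpa only [mul_assoc] using congrArg (· * w) hx'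
    have hc : a * w * (x * w) = x * w * (a * w) :=
      mul_comm_of_star_mul_eq (by simpa only [mul_assoc] using hs)
        (Or.inr (by rw [mul_assoc, hy]))
    refine ⟨x, ?_, ha, hs⟩
    calc a * (w * x) ^ 2 = a * w * (x * w) * x := by simp only [pow_two, mul_assoc]
      _ = x * w * (a * w) * (x * w * (x * w * a)) := by rw [hc, hx']
      _ = x * w * (a * w * (x * w) * (x * w * a)) := by simp only [mul_assoc]
      _ = x * w * (x * w * (a * w * (x * w * a))) := by rw [hc, mul_assoc (x * w) (a * w)]
      _ = x := by rw [ha', hx']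
  tfae_have 2 → 1 := by
    rintro ⟨x, hx, ha, hs⟩
    have hx' : a * w * (x * w * x) = x := by
      simpa only [pow_two, mul_assoc] using hx
    have hy : a * w * (x * w * (x * w)) = x * w := by
      simpa only [mul_assoc] using congrArg (· * w) hx'
    have hc : a * w * (x * w) = x * w * (a * w) :=
      mul_comm_of_star_mul_eq (by simpa only [mul_assoc] using hs)
        (Or.inl (by rw [← mul_assoc, mul_assoc (a * w), hy]))
    have hc' : a * w * x * w = x * w * a * w := by
      simpa only [mul_assoc] using hc
    refine ⟨x, hx, ?_, hs.trans hc'.symm, by rw [← hc', hs, hc']⟩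
    calc x * (w * a) ^ 2 = x * w * a * w * a := by simp only [pow_two, mul_assoc]
      _ = a := by rw [← hc', ha]
  tfae_finish
end

section
/- Let a, w ∈ 𝒜. The following are equivalent: (1) a is w-*-DMP; (2) there exist x ∈ 𝒜 and a natural number n ≥ 1 such that a(wx)² = x, (awxw)* = xwaw, and (aw)^n = xw(aw)^{n+1}; (3) there exists a projection p ∈ 𝒜 (p² = p = p*) such that aw + p is invertible in 𝒜, 1 − p ∈ 𝒜w (i.e., 1 − p = cw for some c ∈ 𝒜), awp = paw, and awp is nilpotent; (4) there exist z ∈ 𝒜 and a natural number n ≥ 1 such that (aw)z = z(aw), z(aw)z = z, (aw)^n = z(aw)^{n+1} (so z is the Drazin inverse of aw), and z²a is w-EP. -/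
variable {A : Type*} [NormedRing A] [StarRing A] [NormedAlgebra ℂ A] [CompleteSpace A]

section Ring

variable {R : Type*} [Ring R] {b y z : R} {n : ℕ}

theorem pow_mul_pow_succ_of_mul_sq (h : b * y ^ 2 = y) (m : ℕ) : b ^ m * y ^ (m + 1) = y := by
  induction m with
  | zero => simp
  | succ m ih =>
    calc b ^ (m + 1) * y ^ (m + 1 + 1) = b ^ m * (b * y ^ 2) * y ^ m := by
          rw [pow_succ b, show m + 1 + 1 = 2 + m by lia, pow_add y]; simp only [mul_assoc]
      _ = y := by rw [h, mul_assoc, ← pow_succ', ih]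

theorem mul_mul_self_of_pow_eq (h : b * y ^ 2 = y) (hn : b ^ n = y * b ^ (n + 1)) :
    y * b * y = y := by
  calc y * b * y = y * b * (b ^ n * y ^ (n + 1)) := by rw [pow_mul_pow_succ_of_mul_sq h]
    _ = y * b ^ (n + 1) * y ^ (n + 1) := by rw [pow_succ' b]; simp only [mul_assoc]
    _ = y := by rw [← hn, pow_mul_pow_succ_of_mul_sq h]

theorem mul_mul_mul_of_pow_eq (h : b * y ^ 2 = y) (hn : b ^ n = y * b ^ (n + 1)) :
    y * b * (b * y) = b * y := by
  calc y * b * (b * y) = y * b * (b * (b ^ n * y ^ (n + 1))) := by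
        rw [pow_mul_pow_succ_of_mul_sq h]
    _ = y * b ^ (n + 1) * b * y ^ (n + 1) := by
        rw [mul_assoc y (b ^ (n + 1)) b, ← pow_succ, pow_succ' b (n + 1), pow_succ' b n]
        simp only [mul_assoc]
    _ = b * (b ^ n * y ^ (n + 1)) := by
        rw [← hn, ← pow_succ, pow_succ', mul_assoc]
    _ = b * y := by rw [pow_mul_pow_succ_of_mul_sq h]

theorem commute_of_isSelfAdjoint_mul [StarRing R] (h : b * y ^ 2 = y)
    (hn : b ^ n = y * b ^ (n + 1)) (h₁ : star (b * y) = b * y) (h₂ : star (y * b) = y * b) :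
    b * y = y * b := by
  have h₃ := congrArg star (mul_mul_mul_of_pow_eq h hn)
  rw [star_mul, h₁, h₂] at h₃
  rw [← h₃, ← mul_assoc, mul_assoc b, ← sq, h]

theorem commute_of_star_mul_eq [StarRing R] (h : b * y ^ 2 = y)
    (hn : b ^ n = y * b ^ (n + 1)) (h₁ : star (b * y) = y * b) :
    b * y = y * b := by
  have h₂ : star (y * b) = b * y := by rw [← h₁, star_star]
  have h₃ := congrArg star (mul_mul_mul_of_pow_eq h hn)
  rwa [star_mul, h₁, h₂, mul_mul_mul_of_pow_eq h hn] at h₃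

theorem isNilpotent_mul_one_sub (hc : b * y = y * b) (hn : b ^ n = y * b ^ (n + 1)) :
    IsNilpotent (b * (1 - b * y)) := by
  have hcomm : Commute b (1 - b * y) :=
    (Commute.one_right b).sub_right ((Commute.refl b).mul_right hc)
  have h₀ : b ^ n * (1 - b * y) = 0 := by
    rw [(hcomm.pow_left n).eq, sub_mul, one_mul, hc, mul_assoc, ← pow_succ', ← hn, sub_self]
  refine ⟨n + 1, ?_⟩
  rw [hcomm.mul_pow, pow_succ' b, pow_succ' (1 - b * y), mul_assoc, ← mul_assoc (b ^ n), h₀,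
    zero_mul, mul_zero]

theorem isUnit_add_one_sub_mul (hc : b * y = y * b) (hy : y * b * y = y)
    (hn : b ^ n = y * b ^ (n + 1)) : IsUnit (b + (1 - b * y)) := by
  have hq : IsIdempotentElem (b * y) := by
    rw [IsIdempotentElem, mul_assoc, ← mul_assoc y, hy]
  have hqy : b * y * y = y := by rw [hc, hy]
  have hyq : y * (b * y) = y := by rw [← mul_assoc, hy]
  have hqb : b * y * b = b * (b * y) := by rw [mul_assoc, ← hc]
  have h₁ : IsUnit (1 + b * (1 - b * y)) := (isNilpotent_mul_one_sub hc hn).isUnit_one_add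
  have h₂ : IsUnit (b * (b * y) + (1 - b * y)) := by
    refine isUnit_iff_exists.mpr ⟨y + (1 - b * y), ?_, ?_⟩
    · have e₁ : b * (b * y) * y = b * y := by rw [mul_assoc, hqy]
      have e₂ : b * (b * y) * (1 - b * y) = 0 := by rw [mul_assoc, hq.mul_one_sub_self, mul_zero]
      have e₃ : (1 - b * y) * y = 0 := by rw [sub_mul, one_mul, hqy, sub_self]
      rw [add_mul, mul_add, mul_add, e₁, e₂, e₃, hq.one_sub.eq]
      abel
    · have e₁ : y * (b * (b * y)) = b * y := by rw [← mul_assoc, ← hc, hq.eq]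
      have e₂ : y * (1 - b * y) = 0 := by rw [mul_sub, mul_one, hyq, sub_self]
      have e₃ : (1 - b * y) * (b * (b * y)) = 0 := by
        rw [← hqb, ← mul_assoc, hq.one_sub_mul_self, zero_mul]
      rw [add_mul, mul_add, mul_add, e₁, e₂, e₃, hq.one_sub.eq]
      abel
  convert h₂.mul h₁ using 1
  have e₁ : b * (b * y) * (b * (1 - b * y)) = 0 := by
    rw [mul_assoc, ← mul_assoc (b * y), hqb, mul_assoc b, hq.mul_one_sub_self, mul_zero, mul_zero]
  have e₂ : (1 - b * y) * (b * (1 - b * y)) = b * (1 - b * y) := by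
    rw [← mul_assoc, sub_mul, one_mul, hqb, ← mul_one_sub, mul_assoc, hq.one_sub.eq]
  rw [add_mul, mul_add, mul_add, mul_one, mul_one, e₁, e₂, mul_sub, mul_one]
  abel

theorem mul_eq_mul_of_commute_isSelfAdjoint [StarRing R] (hzb : b * z = z * b)
    (hz : z * b * z = z) (h₁ : z * y ^ 2 = y) (h₂ : y * z ^ 2 = z)
    (h₃ : star (z * y) = z * y) (h₄ : star (y * z) = y * z) : b * z = z * y := by
  have hc : z * y = y * z :=
    commute_of_isSelfAdjoint_mul (n := 1) h₁ (by rw [pow_one, h₂]) h₃ h₄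
  calc b * z = b * (y * z ^ 2) := by rw [h₂]
    _ = b * z * (z * y) := by rw [sq, ← mul_assoc y, ← hc, mul_assoc z, ← hc, ← mul_assoc]
    _ = z * b * z * y := by rw [hzb, mul_assoc, mul_assoc, mul_assoc]
    _ = z * y := by rw [hz]

theorem mul_sq_of_mul_mul_sq {a w x : R} (h : a * (w * x) ^ 2 = x) :
    a * w * (x * w) ^ 2 = x * w := by
  conv_rhs => rw [← h]
  simp only [sq, mul_assoc]

end Ring

theorem stmt_17 (a w : A) :
    [ IsWStarDMP w a,
      (∃ x : A, ∃ n : ℕ, 1 ≤ n ∧ a * (w * x) ^ 2 = x ∧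
        star (a * w * x * w) = x * w * a * w ∧
        (a * w) ^ n = x * w * (a * w) ^ (n + 1)),
      (∃ p : A, p ^ 2 = p ∧ star p = p ∧ IsUnit (a * w + p) ∧
        (∃ c : A, 1 - p = c * w) ∧ a * w * p = p * (a * w) ∧
        IsNilpotent (a * w * p)),
      (∃ z : A, ∃ n : ℕ, 1 ≤ n ∧ (a * w) * z = z * (a * w) ∧
        z * (a * w) * z = z ∧ (a * w) ^ n = z * (a * w) ^ (n + 1) ∧
        IsWEP w (z ^ 2 * a)) ].TFAE := by
  tfae_have 1 → 2 := by
    rintro ⟨x, n, hn, h, h₁, h₂, hp⟩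
    have hb : a * w * (x * w) ^ 2 = x * w := mul_sq_of_mul_mul_sq h
    have hc := commute_of_isSelfAdjoint_mul hb hp (by simpa only [mul_assoc] using h₁)
      (by simpa only [mul_assoc] using h₂)
    refine ⟨x, n, hn, h, ?_, hp⟩
    rw [h₁, mul_assoc _ x, hc, ← mul_assoc]
  tfae_have 2 → 3 := by
    rintro ⟨x, n, hn, h, h₁, hp⟩
    have hb : a * w * (x * w) ^ 2 = x * w := mul_sq_of_mul_mul_sq h
    have hs : star (a * w * (x * w)) = x * w * (a * w) := by simpa only [mul_assoc] using h₁
    have hc := commute_of_star_mul_eq hb hp hs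
    have hy := mul_mul_self_of_pow_eq hb hp
    have hidem : IsIdempotentElem (a * w * (x * w)) := by
      rw [IsIdempotentElem, mul_assoc (a * w), ← mul_assoc (x * w), hy]
    refine ⟨1 - a * w * (x * w), ?_, ?_, isUnit_add_one_sub_mul hc hy hp,
      ⟨a * w * x, by rw [sub_sub_cancel, mul_assoc _ x]⟩, ?_, isNilpotent_mul_one_sub hc hp⟩
    · rw [sq, hidem.one_sub.eq]
    · rw [star_sub, star_one, hs, hc]
    · rw [mul_sub, sub_mul, mul_one, one_mul, mul_assoc (a * w) (x * w), ← hc]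
  tfae_have 3 → 1 := by
    rintro ⟨p, hp, hps, ⟨u, hu⟩, ⟨c, hcw⟩, hcomm, m, hm⟩
    have hp' : IsIdempotentElem p := by rw [IsIdempotentElem, ← sq, hp]
    have hbp : Commute (a * w) p := hcomm
    have hup : Commute (u : A) (1 - p) := by
      rw [hu]
      exact (Commute.one_right _).sub_right (hbp.add_left (Commute.refl p))
    have hvp : (↑u⁻¹ : A) * (1 - p) = (1 - p) * ↑u⁻¹ := hup.units_inv_left.eq
    have hbu : a * w * (1 - p) = u * (1 - p) := by
      rw [hu, add_mul, hp'.mul_one_sub_self, add_zero]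
    have hqb : (1 - p) * (a * w) = a * w * (1 - p) := by
      rw [sub_mul, mul_sub, one_mul, mul_one, hcomm]
    have hy : ↑u⁻¹ * (1 - p) * c * w = ↑u⁻¹ * (1 - p) := by
      rw [mul_assoc, ← hcw, mul_assoc, hp'.one_sub.eq]
    have hby : a * w * (↑u⁻¹ * (1 - p)) = 1 - p := by
      rw [hvp, ← mul_assoc, hbu, hup.eq, mul_assoc, Units.mul_inv, mul_one]
    have hyb : ↑u⁻¹ * (1 - p) * (a * w) = 1 - p := by
      rw [mul_assoc, hqb, hbu, ← mul_assoc, Units.inv_mul, one_mul]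
    have hqs : star (1 - p) = 1 - p := by rw [star_sub, star_one, hps]
    have hpow : p * (a * w) ^ (m + 1) = 0 := by
      rw [← (hbp.pow_left (m + 1)).eq]
      conv_lhs => rw [← hp'.pow_succ_eq m]
      rw [← hbp.mul_pow, pow_succ, hm, zero_mul]
    refine ⟨↑u⁻¹ * (1 - p) * c, m + 1, by lia, ?_, ?_, ?_, ?_⟩
    · calc a * (w * (↑u⁻¹ * (1 - p) * c)) ^ 2
          = a * w * (↑u⁻¹ * (1 - p) * c * w) * (↑u⁻¹ * (1 - p) * c) := by
            simp only [sq, mul_assoc]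
        _ = ↑u⁻¹ * (1 - p) * c := by
            rw [hy, hby, hvp, ← mul_assoc, ← mul_assoc, hp'.one_sub.eq]
    · rw [mul_assoc (a * w), hy, hby, hqs]
    · rw [hy, mul_assoc _ a w, hyb, hqs]
    · rw [hy, pow_succ' _ (m + 1), ← mul_assoc, hyb, sub_mul, one_mul, hpow, sub_zero]
  tfae_have 1 → 4 := by
    rintro ⟨x, n, hn, h, h₁, h₂, hp⟩
    have hb : a * w * (x * w) ^ 2 = x * w := mul_sq_of_mul_mul_sq h
    have hs : star (a * w * (x * w)) = a * w * (x * w) := by simpa only [mul_assoc] using h₁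
    have hc := commute_of_isSelfAdjoint_mul hb hp hs (by simpa only [mul_assoc] using h₂)
    have hy := mul_mul_self_of_pow_eq hb hp
    have hx : a * w * (x * w) * x = x := by
      conv_rhs => rw [← h]
      simp only [sq, mul_assoc]
    obtain ⟨b, hbdef⟩ : ∃ b, a * w = b := ⟨_, rfl⟩
    obtain ⟨y, hydef⟩ : ∃ y, x * w = y := ⟨_, rfl⟩
    rw [hbdef, hydef] at hc hy hb hs
    rw [hbdef, hydef] at hx
    have hbyy : b * y * y = y := by rw [hc, hy]
    have hyyb : y ^ 2 * b = y := by rw [sq, mul_assoc, ← hc, ← mul_assoc, hy]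
    have hαw : y ^ 2 * a * w = y := by rw [mul_assoc, hbdef, hyyb]
    have hXw : b ^ 2 * x * w = b ^ 2 * y := by rw [mul_assoc, hydef]
    have hyX : y * (b ^ 2 * y) = b * y := by
      rw [sq, ← mul_assoc, ← mul_assoc, ← hc, mul_assoc (b * y), mul_assoc b, ← mul_assoc y, hy]
    have hXy : b ^ 2 * y * y = b * y := by rw [sq, mul_assoc, mul_assoc, ← mul_assoc b y, hbyy]
    refine ⟨y, n, hn, by rw [hbdef, hc], by rw [hbdef, hy], by rw [← hydef, hp],
      b ^ 2 * x, ?_, ?_, ?_, ?_⟩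
    · calc y ^ 2 * a * (w * (b ^ 2 * x)) ^ 2
          = y ^ 2 * a * w * (b ^ 2 * x * w) * (b ^ 2 * x) := by simp only [sq, mul_assoc]
        _ = b * (y * b) * (b * x) := by rw [hαw, hXw, hyX, sq]; simp only [mul_assoc]
        _ = b ^ 2 * (y * b * x) := by
            conv_lhs => rw [← hc]
            simp only [sq, mul_assoc]
        _ = b ^ 2 * x := by rw [← hc, hx]
    · calc b ^ 2 * x * (w * (y ^ 2 * a)) ^ 2
          = b ^ 2 * x * w * (y ^ 2 * a * w) * (y ^ 2 * a) := by simp only [sq, mul_assoc]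
        _ = b * y * y * y * a := by rw [hαw, hXw, hXy, sq]; simp only [mul_assoc]
        _ = y ^ 2 * a := by rw [hbyy, sq]
    · rw [mul_assoc _ _ w, hαw, hXw, hyX, hs]
    · rw [mul_assoc _ _ w, hXw, hαw, hXy, hs]
  tfae_have 4 → 1 := by
    rintro ⟨z, n, hn, hc, hz, hp, X, h₁, h₂, h₃, h₄⟩
    have hzw : z ^ 2 * a * w = z := by
      rw [sq, mul_assoc, mul_assoc z z, ← hc, ← mul_assoc, hz]
    have hY : z * (X * w) ^ 2 = X * w := by
      simpa only [hzw] using mul_sq_of_mul_mul_sq h₁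
    have hYz : X * w * z ^ 2 = z := by
      simpa only [hzw] using mul_sq_of_mul_mul_sq h₂
    have hbz : a * w * z = z * (X * w) :=
      mul_eq_mul_of_commute_isSelfAdjoint hc hz hY hYz
        (by rw [hzw, mul_assoc] at h₃; exact h₃)
        (by rw [mul_assoc (X * w), hzw] at h₄; exact h₄)
    have hs : star (a * w * z) = a * w * z := by
      rw [hbz]; rw [hzw, mul_assoc] at h₃; exact h₃
    refine ⟨z ^ 2 * a, n, hn, ?_, ?_, ?_, by rw [hzw, hp]⟩
    · calc a * (w * (z ^ 2 * a)) ^ 2 = a * w * (z ^ 2 * a * w) * (z ^ 2 * a) := by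
            simp only [sq, mul_assoc]
        _ = z * (a * w) * z * z * a := by rw [hzw, hc, sq]; simp only [mul_assoc]
        _ = z ^ 2 * a := by rw [hz, sq]
    · rw [mul_assoc (a * w), hzw, hs]
    · rw [hzw, mul_assoc z, ← hc, hs]
  tfae_finish
end
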